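/- The map τ intertwines the two shuffle products: for f, g symmetric Laurent polynomials as above in disjoint variables for dimension vectors α•, β•, one has τ_{α•+β•}(f * g) = τ_{α•}(f) ⋆ τ_{β•}(g), as formal power series in the arrow variables t_b with coefficients Laurent polynomials in the combined variables, symmetric at each vertex. -/

import Mathlib

open scoped BigOperators

namespace Shuffle

noncomputable section

/-- The field of rational functions in the variables indexed by `V`: the fraction field of
the multivariate polynomial ring.  Laurent polynomials in the variables `X v` are viewed
inside this field, and the geometric series `(1 - t·x/y)⁻¹` is the honest inverse here. -/
abbrev FF (V : Type) : Type := FractionRing (MvPolynomial V ℚ)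

/-- The variable `X v`, viewed in the rational function field. -/
def xv {V : Type} (v : V) : FF V := algebraMap (MvPolynomial V ℚ) (FF V) (MvPolynomial.X v)

/-- The action of a permutation of the variables on the rational function field,
by renaming variables. -/
def act {V : Type} (σ : Equiv.Perm V) : FF V →+* FF V :=
  IsFractionRing.lift (g := (algebraMap (MvPolynomial V ℚ) (FF V)).comp
      (MvPolynomial.rename σ : MvPolynomial V ℚ →ₐ[ℚ] MvPolynomial V ℚ).toRingHom)
    ((IsFractionRing.injective (MvPolynomial V ℚ) (FF V)).comp
      (MvPolynomial.rename_injective σ σ.injective))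

variable {X Q0 Q1 : Type} [Fintype X] [DecidableEq X] [Fintype Q0] [DecidableEq Q0]
  [Fintype Q1] [DecidableEq Q1]

/-- The `x`-variable indexed by `x : X`, inside the field of rational functions in
the `x`-variables and the arrow variables. -/
def xx (Q1 : Type) (x : X) : FF (X ⊕ Q1) := xv (Sum.inl x)

/-- The arrow variable `t_b`. -/
def tt (X : Type) (b : Q1) : FF (X ⊕ Q1) := xv (Sum.inr b)

/-- Extension of a permutation of the `x`-variables by the identity on the arrow
variables. -/
def permExt (Q1 : Type) (σ : Equiv.Perm X) : Equiv.Perm (X ⊕ Q1) :=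
  Equiv.sumCongr σ (Equiv.refl Q1)

/-- The monomial `x^β` with integer exponents. -/
def xmon (Q1 : Type) (β : X → ℤ) : FF (X ⊕ Q1) := ∏ x : X, (xx Q1 x) ^ (β x)

/-- The staircase exponent for the variables in `S`: each variable `x ∈ S` gets the number
of variables in `S` at the same vertex that come after it (so at each vertex the variables
of `S` receive `ν - 1, ν - 2, …, 1, 0` in their listed order). -/
def rhoS (vert : X → Q0) (lt : X → X → Prop) [DecidableRel lt] (S : Finset X) : X → ℤ :=
  fun x => if x ∈ S then ((S.filter (fun y => vert y = vert x ∧ lt x y)).card : ℤ) else 0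

/-- The antisymmetrizer `J• = Σ (−1)^{w•} w•` over the permutations of the variables in `S`
preserving the vertex of each variable (and fixing all other variables). -/
def Jsym (vert : X → Q0) (S : Finset X) (f : FF (X ⊕ Q1)) : FF (X ⊕ Q1) :=
  ∑ σ ∈ Finset.univ.filter (fun σ : Equiv.Perm X =>
      (∀ x, vert (σ x) = vert x) ∧ ∀ x ∉ S, σ x = x),
    ((Equiv.Perm.sign σ : ℤˣ) : ℤ) • act (permExt Q1 σ) f

/-- The Demazure symmetrizer `D_{w₀•}(f) = J•(x^{ρ•})⁻¹ · J•(x^{ρ•} f)` over the variables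
in `S`, symmetrizing at each vertex. -/
def Dem (vert : X → Q0) (lt : X → X → Prop) [DecidableRel lt] (S : Finset X)
    (f : FF (X ⊕ Q1)) : FF (X ⊕ Q1) :=
  (Jsym vert S (xmon Q1 (rhoS vert lt S)))⁻¹ * Jsym vert S (xmon Q1 (rhoS vert lt S) * f)

/-- The subring of Laurent polynomials over `ℤ[t_b^{±1} : b ∈ Q₁]` in the `x`-variables
belonging to `S`. -/
def LaurentIn (Q1 : Type) [Fintype Q1] (S : Finset X) : Subring (FF (X ⊕ Q1)) :=
  Subring.closure
    ((fun x : X => xx Q1 x) '' ↑S ∪ (fun x : X => (xx Q1 x)⁻¹) '' ↑S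
      ∪ Set.range (tt X (Q1 := Q1)) ∪ Set.range (fun b : Q1 => (tt X b)⁻¹))

/-- `f` is symmetric in the variables of `S` at each vertex. -/
def SymmOn (Q1 : Type) (vert : X → Q0) (S : Finset X) (f : FF (X ⊕ Q1)) : Prop :=
  ∀ σ : Equiv.Perm X, (∀ x, vert (σ x) = vert x) → (∀ x ∉ S, σ x = x) →
    act (permExt Q1 σ) f = f

/-- The shuffle product `f * g` of `f` (in the variables of `A`) and `g` (in the variables
of `B`): `D_{w₀•}(f · g · ∏_b ∏_{y ∈ B, vert y = tb} ∏_{x ∈ A, vert x = hb}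
(1 − t_b y/x))`. -/
def starMul (vert : X → Q0) (hd tl : Q1 → Q0) (lt : X → X → Prop) [DecidableRel lt]
    (A B : Finset X) (f g : FF (X ⊕ Q1)) : FF (X ⊕ Q1) :=
  Dem vert lt (A ∪ B) (f * g *
    ∏ b : Q1, ∏ y ∈ B.filter (fun y => vert y = tl b), ∏ x ∈ A.filter (fun x => vert x = hd b),
      (1 - tt X b * xx Q1 y / xx Q1 x))

/-- The shuffle product `f ⋆ g` of `f` (in the variables of `A`) and `g` (in the variables
of `B`): `D_{w₀•}(f · g · ∏_b ∏_{x ∈ A, vert x = tb} ∏_{y ∈ B, vert y = hb}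
(1 − t_b x/y)⁻¹)`. -/
def starGeom (vert : X → Q0) (hd tl : Q1 → Q0) (lt : X → X → Prop) [DecidableRel lt]
    (A B : Finset X) (f g : FF (X ⊕ Q1)) : FF (X ⊕ Q1) :=
  Dem vert lt (A ∪ B) (f * g *
    ∏ b : Q1, ∏ x ∈ A.filter (fun x => vert x = tl b), ∏ y ∈ B.filter (fun y => vert y = hd b),
      (1 - tt X b * xx Q1 x / xx Q1 y)⁻¹)

end

end Shuffle

namespace Shuffle

noncomputable section

variable {X Q0 Q1 : Type} [Fintype X] [DecidableEq X] [Fintype Q0] [DecidableEq Q0]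
  [Fintype Q1] [DecidableEq Q1]

/-- The map `τ_S(h) = h · ∏_b ∏_{x ∈ S, vert x = hb} ∏_{y ∈ S, vert y = tb}
(1 − t_b y/x)⁻¹`, multiplying by the character of `Sym(E_S^∨)`. -/
def tauMap (vert : X → Q0) (hd tl : Q1 → Q0) (S : Finset X) (h : FF (X ⊕ Q1)) :
    FF (X ⊕ Q1) :=
  h * ∏ b : Q1, ∏ x ∈ S.filter (fun x => vert x = hd b), ∏ y ∈ S.filter (fun y => vert y = tl b),
    (1 - tt X b * xx Q1 y / xx Q1 x)⁻¹

end

end Shuffle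

namespace Shuffle

theorem act_xv {V : Type} (σ : Equiv.Perm V) (v : V) : act σ (xv v) = xv (σ v) := by
  simp [act, xv, IsFractionRing.lift_algebraMap]

theorem act_xx {X Q1 : Type} (σ : Equiv.Perm X) (x : X) :
    act (permExt Q1 σ) (xx Q1 x) = xx Q1 (σ x) := by
  simp [xx, act_xv, permExt]

theorem act_tt {X Q1 : Type} (σ : Equiv.Perm X) (b : Q1) :
    act (permExt Q1 σ) (tt X b) = tt X b := by
  simp [tt, act_xv, permExt]

theorem xx_ne_zero {X Q1 : Type} (x : X) : xx Q1 x ≠ 0 := by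
  rw [xx, xv, Ne, FaithfulSMul.algebraMap_eq_zero_iff]
  exact MvPolynomial.X_ne_zero _

/-- The factors `1 - t_b y / x` do not vanish. -/
theorem one_sub_tt_mul_div_ne_zero {X Q1 : Type} (b : Q1) (x y : X) :
    1 - tt X b * xx Q1 y / xx Q1 x ≠ 0 := by
  intro h
  rw [sub_eq_zero, eq_div_iff (xx_ne_zero x), one_mul] at h
  simp only [xx, tt, xv, ← map_mul] at h
  have hpoly := IsFractionRing.injective (MvPolynomial (X ⊕ Q1) ℚ) (FF (X ⊕ Q1)) h
  have heval := congrArg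
    (MvPolynomial.eval (Sum.elim (fun _ => (1 : ℚ)) (fun _ : Q1 => (0 : ℚ)))) hpoly
  simp at heval

variable {X Q0 Q1 : Type} [DecidableEq Q0]

/-- The antisymmetrizer is linear over elements symmetric in the variables of `S`. -/
theorem Jsym_mul_of_symmOn [Fintype X] [DecidableEq X]
    (vert : X → Q0) (S : Finset X) {s : FF (X ⊕ Q1)}
    (hs : SymmOn Q1 vert S s) (h : FF (X ⊕ Q1)) :
    Jsym vert S (h * s) = Jsym vert S h * s := by
  rw [Jsym, Jsym, Finset.sum_mul]
  refine Finset.sum_congr rfl fun σ hσ => ?_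
  obtain ⟨hvert, hfix⟩ := (Finset.mem_filter.mp hσ).2
  rw [map_mul, hs σ hvert hfix, smul_mul_assoc]

theorem Dem_mul_of_symmOn [Fintype X] [DecidableEq X]
    (vert : X → Q0) (lt : X → X → Prop) [DecidableRel lt] (S : Finset X)
    {s : FF (X ⊕ Q1)} (hs : SymmOn Q1 vert S s) (h : FF (X ⊕ Q1)) :
    Dem vert lt S (h * s) = Dem vert lt S h * s := by
  rw [Dem, Dem, ← mul_assoc (xmon Q1 _), Jsym_mul_of_symmOn vert S hs, mul_assoc]

/-- Symmetric reindexing of a product over the variables of `S` at one vertex. -/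
theorem prod_filter_vert_perm {M : Type} [CommMonoid M] (vert : X → Q0) (S : Finset X)
    (σ : Equiv.Perm X) (hvert : ∀ x, vert (σ x) = vert x) (hfix : ∀ x ∉ S, σ x = x) (i : Q0)
    (F : X → M) :
    ∏ x ∈ S.filter (fun x => vert x = i), F (σ x) = ∏ x ∈ S.filter (fun x => vert x = i), F x := by
  have hmem : ∀ x, σ x ∈ S ↔ x ∈ S := fun x => by
    by_cases hx : x ∈ S
    · refine iff_of_true (by_contra fun hσx => hσx ?_) hx
      rwa [σ.injective (hfix _ hσx)]
    · rw [hfix x hx]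
  exact Finset.prod_equiv σ (fun x => by simp [hmem, hvert]) (fun _ _ => rfl)

variable [Fintype Q1]

/-- The product of `(1 - t_b y / x)⁻¹` over arrows `b`, variables `x` of `H` at the head of `b`
and variables `y` of `T` at its tail. -/
noncomputable def arrowKernel (vert : X → Q0) (hd tl : Q1 → Q0) (H T : Finset X) : FF (X ⊕ Q1) :=
  ∏ b : Q1, ∏ x ∈ H.filter (fun x => vert x = hd b), ∏ y ∈ T.filter (fun y => vert y = tl b),
    (1 - tt X b * xx Q1 y / xx Q1 x)⁻¹

theorem symmOn_arrowKernel (vert : X → Q0) (hd tl : Q1 → Q0) (S : Finset X) :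
    SymmOn Q1 vert S (arrowKernel vert hd tl S S) := by
  intro σ hvert hfix
  simp only [arrowKernel, map_prod, map_inv₀, map_sub, map_one, map_div₀, map_mul, act_tt, act_xx]
  refine Finset.prod_congr rfl fun b _ => ?_
  rw [prod_filter_vert_perm vert S σ hvert hfix (hd b) fun x =>
    ∏ y ∈ S.filter (fun y => vert y = tl b), (1 - tt X b * xx Q1 (σ y) / xx Q1 x)⁻¹]
  exact Finset.prod_congr rfl fun x _ => prod_filter_vert_perm vert S σ hvert hfix (tl b) fun y =>
    (1 - tt X b * xx Q1 y / xx Q1 x)⁻¹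

theorem arrowKernel_union_left [DecidableEq X] (vert : X → Q0) (hd tl : Q1 → Q0)
    {A B : Finset X}
    (hAB : Disjoint A B) (T : Finset X) :
    arrowKernel vert hd tl (A ∪ B) T =
      arrowKernel vert hd tl A T * arrowKernel vert hd tl B T := by
  simp only [arrowKernel, Finset.filter_union, ← Finset.prod_mul_distrib]
  exact Finset.prod_congr rfl fun b _ =>
    Finset.prod_union (Finset.disjoint_filter_filter hAB)

theorem arrowKernel_union_right [DecidableEq X] (vert : X → Q0) (hd tl : Q1 → Q0)
    {A B : Finset X}
    (hAB : Disjoint A B) (H : Finset X) :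
    arrowKernel vert hd tl H (A ∪ B) =
      arrowKernel vert hd tl H A * arrowKernel vert hd tl H B := by
  simp only [arrowKernel, Finset.filter_union, ← Finset.prod_mul_distrib]
  exact Finset.prod_congr rfl fun b _ => Finset.prod_congr rfl fun x _ =>
    Finset.prod_union (Finset.disjoint_filter_filter hAB)

theorem prod_mul_arrowKernel (vert : X → Q0) (hd tl : Q1 → Q0) (H T : Finset X) :
    (∏ b : Q1, ∏ y ∈ T.filter (fun y => vert y = tl b), ∏ x ∈ H.filter (fun x => vert x = hd b),
      (1 - tt X b * xx Q1 y / xx Q1 x)) * arrowKernel vert hd tl H T = 1 := by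
  rw [arrowKernel, ← Finset.prod_mul_distrib]
  refine Finset.prod_eq_one fun b _ => ?_
  rw [Finset.prod_comm, ← Finset.prod_mul_distrib]
  refine Finset.prod_eq_one fun x _ => ?_
  rw [← Finset.prod_mul_distrib]
  exact Finset.prod_eq_one fun y _ => mul_inv_cancel₀ (one_sub_tt_mul_div_ne_zero b x y)

theorem tauMap_eq (vert : X → Q0) (hd tl : Q1 → Q0) (S : Finset X) (h : FF (X ⊕ Q1)) :
    tauMap vert hd tl S h = h * arrowKernel vert hd tl S S := rfl

theorem arrowKernel_eq_prod_tail_head (vert : X → Q0) (hd tl : Q1 → Q0) (H T : Finset X) :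
    arrowKernel vert hd tl H T =
      ∏ b : Q1, ∏ y ∈ T.filter (fun y => vert y = tl b), ∏ x ∈ H.filter (fun x => vert x = hd b),
        (1 - tt X b * xx Q1 y / xx Q1 x)⁻¹ :=
  Finset.prod_congr rfl fun _ _ => Finset.prod_comm

theorem starGeom_eq [Fintype X] [DecidableEq X]
    (vert : X → Q0) (hd tl : Q1 → Q0) (lt : X → X → Prop) [DecidableRel lt]
    (A B : Finset X) (f g : FF (X ⊕ Q1)) :
    starGeom vert hd tl lt A B f g =
      Dem vert lt (A ∪ B) (f * g * arrowKernel vert hd tl B A) := by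
  rw [starGeom, arrowKernel_eq_prod_tail_head]

end Shuffle

open Shuffle in
/-- the map `τ` intertwines the two shuffle products:
`τ_{α•+β•}(f * g) = τ_{α•}(f) ⋆ τ_{β•}(g)`. -/
theorem stmt_12
    (Q0 Q1 X : Type) [Fintype Q0] [DecidableEq Q0] [Fintype Q1] [DecidableEq Q1]
    [Fintype X] [DecidableEq X] [LinearOrder X]
    (hd tl : Q1 → Q0)
    (vert : X → Q0)
    (A B : Finset X)
    (hAB : Disjoint A B)
    -- the variables are listed in the order: those of `A`, then those of `B`
    (hABo : ∀ x ∈ A, ∀ y ∈ B, x < y)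
    (f g : FF (X ⊕ Q1))
    (hfL : f ∈ LaurentIn Q1 A) (hfS : SymmOn Q1 vert A f)
    (hgL : g ∈ LaurentIn Q1 B) (hgS : SymmOn Q1 vert B g) :
    tauMap vert hd tl (A ∪ B) (starMul vert hd tl (· < ·) A B f g)
      = starGeom vert hd tl (· < ·) A B (tauMap vert hd tl A f) (tauMap vert hd tl B g) := by
  rw [tauMap_eq, starGeom_eq, starMul,
    ← Dem_mul_of_symmOn vert _ _ (symmOn_arrowKernel vert hd tl (A ∪ B)), tauMap_eq, tauMap_eq,
    arrowKernel_union_left vert hd tl hAB, arrowKernel_union_right vert hd tl hAB,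
    arrowKernel_union_right vert hd tl hAB]
  congr 1
  linear_combination (f * g * arrowKernel vert hd tl A A * arrowKernel vert hd tl B A *
    arrowKernel vert hd tl B B) * prod_mul_arrowKernel vert hd tl A B
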